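/- (Lemma 4.10, coarse bound for the last policy) Assume ε ∈ (0,1]. There exist constants C > 0 and c₃, c₄ ≥ 1, all independent of H, X, A, ε, and δ, such that when the sample-based MDVI algorithm is run with α = 1 − (1−γ)², K = ⌈(5/(1−α))·log(c₃H/ε) + 2⌉, and M = ⌈(c₄H/ε²)·log(16KXA/δ)⌉, then on the event 𝓔₁ ∩ 𝓔₂ its output policies satisfy both ‖V* − V^{π'_k}‖_∞ ≤ C·H·α^k + C·ε·√(H/c₄) and ‖V* − V^{π_k}‖_∞ ≤ C·H·α^k + C·ε·√(H/c₄) for all k ∈ {1,…,K}. -/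

import Mathlib

open MeasureTheory ProbabilityTheory Finset Real

noncomputable section

/-- The transition kernel `P` applied to a state-value function:
`(Pv)(x,a) = Σ_z P(z|x,a) v(z)`. -/
def mdpP {S A : Type} [Fintype S] (P : S → A → S → ℝ) (v : S → ℝ) : S → A → ℝ :=
  fun x a => ∑ z, P x a z * v z

/-- A policy applied to a Q-function: `(poq)(x) = Σ_a po(a|x) q(x,a)`. -/
def polAct {S A : Type} [Fintype A] (po : S → A → ℝ) (q : S → A → ℝ) : S → ℝ :=
  fun x => ∑ a, po x a * q x a

/-- `P` is a transition kernel. -/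
def IsKernel {S A : Type} [Fintype S] (P : S → A → S → ℝ) : Prop :=
  (∀ x a z, 0 ≤ P x a z) ∧ ∀ x a, ∑ z, P x a z = 1

/-- `po` is a (Markov) policy. -/
def IsPolicy {S A : Type} [Fintype A] (po : S → A → ℝ) : Prop :=
  (∀ x a, 0 ≤ po x a) ∧ ∀ x, ∑ a, po x a = 1

/-- The deterministic policy induced by `d : S → A`. -/
def detPol {S A : Type} [DecidableEq A] (d : S → A) : S → A → ℝ :=
  fun x a => if a = d x then 1 else 0

/-- The Bellman operator `T^po q = r + γ P (po q)`. -/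
def bellmanOp {S A : Type} [Fintype S] [Fintype A] (P : S → A → S → ℝ) (r : S → A → ℝ)
    (γ : ℝ) (po : S → A → ℝ) (qf : S → A → ℝ) : S → A → ℝ :=
  fun x a => r x a + γ * mdpP P (polAct po qf) x a

/-- `P^po = Ppo` acting on Q-functions. -/
def Ppi {S A : Type} [Fintype S] [Fintype A] (P : S → A → S → ℝ) (po : S → A → ℝ)
    (qf : S → A → ℝ) : S → A → ℝ :=
  mdpP P (polAct po qf)

/-- `PprodN P po j n` is `P^{po_{j+n-1}} ⋯ P^{po_j}` (`n` factors, identity for `n = 0`);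
this is `P_j^i` of the paper with `n = i + 1 - j` factors. -/
def PprodN {S A : Type} [Fintype S] [Fintype A] (P : S → A → S → ℝ)
    (po : ℕ → S → A → ℝ) (j : ℕ) : ℕ → (S → A → ℝ) → S → A → ℝ
  | 0, qf => qf
  | n + 1, qf => Ppi P (po (j + n)) (PprodN P po j n qf)

/-- The conditional standard deviation `σ(v)(x,a) = √(P(v²)(x,a) − (Pv)(x,a)²)`. -/
def sigmaP {S A : Type} [Fintype S] (P : S → A → S → ℝ) (v : S → ℝ) : S → A → ℝ :=
  fun x a => Real.sqrt (mdpP P (fun z => v z ^ 2) x a - (mdpP P v x a) ^ 2)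

/-- `𝒩^po = Σ_{t=0}^∞ (γ po P)^t` acting on state-value functions. -/
def Npol {S A : Type} [Fintype S] [Fintype A] (P : S → A → S → ℝ) (γ : ℝ)
    (po : S → A → ℝ) (vf : S → ℝ) : S → ℝ :=
  fun x => ∑' t : ℕ, ((fun uf : S → ℝ => fun z => γ * polAct po (mdpP P uf) z)^[t] vf) x

section MDPLemmas

variable {S A : Type}

lemma mdpP_le_combination [Fintype S] {P : S → A → S → ℝ} (hP : IsKernel P) {f g h : S → ℝ} {c d B : ℝ}
    (hle : ∀ z, f z ≤ c * g z + d * h z + B) (x : S) (a : A) :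
    mdpP P f x a ≤ c * mdpP P g x a + d * mdpP P h x a + B := by
  have hB : B = ∑ z, P x a z * B := by rw [← Finset.sum_mul, hP.2, one_mul]
  unfold mdpP
  rw [hB, Finset.mul_sum, Finset.mul_sum, ← Finset.sum_add_distrib, ← Finset.sum_add_distrib]
  refine Finset.sum_le_sum fun z _ => ?_
  nlinarith [mul_le_mul_of_nonneg_left (hle z) (hP.1 x a z)]

lemma mdpP_le [Fintype S] {P : S → A → S → ℝ} (hP : IsKernel P) {f : S → ℝ} {B : ℝ}
    (hle : ∀ z, f z ≤ B) (x : S) (a : A) : mdpP P f x a ≤ B := by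
  have := mdpP_le_combination hP (f := f) (g := f) (h := f) (c := 0) (d := 0) (B := B)
    (fun z => by linarith [hle z]) x a
  linarith

lemma le_mdpP [Fintype S] {P : S → A → S → ℝ} (hP : IsKernel P) {f : S → ℝ} {B : ℝ}
    (hle : ∀ z, B ≤ f z) (x : S) (a : A) : B ≤ mdpP P f x a := by
  have := mdpP_le_combination hP (f := fun _ => B) (g := f) (h := f) (c := 1) (d := 0) (B := 0)
    (fun z => by linarith [hle z]) x a
  have hB : mdpP P (fun _ => B) x a = B := by
    unfold mdpP
    rw [← Finset.sum_mul, hP.2, one_mul]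
  linarith

lemma polAct_le_of_le [Fintype A] {po : S → A → ℝ} (hpo : IsPolicy po) {q : S → A → ℝ} {x : S} {B : ℝ}
    (hle : ∀ a, q x a ≤ B) : polAct po q x ≤ B := by
  calc polAct po q x ≤ ∑ a, po x a * B :=
        Finset.sum_le_sum fun a _ => mul_le_mul_of_nonneg_left (hle a) (hpo.1 x a)
    _ = B := by rw [← Finset.sum_mul, hpo.2, one_mul]

lemma polAct_neg [Fintype A] (po q : S → A → ℝ) (x : S) :
    polAct po (fun x a => -q x a) x = -polAct po q x := by
  simp [polAct]

lemma le_polAct_of_le [Fintype A] {po : S → A → ℝ} (hpo : IsPolicy po) {q : S → A → ℝ} {x : S} {B : ℝ}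
    (hle : ∀ a, B ≤ q x a) : B ≤ polAct po q x := by
  have := polAct_le_of_le hpo (q := fun x a => -q x a) (x := x) (B := -B)
    (fun a => neg_le_neg (hle a))
  rw [polAct_neg] at this
  linarith

lemma abs_polAct_le [Fintype A] {po : S → A → ℝ} (hpo : IsPolicy po) {q : S → A → ℝ} {x : S} {B : ℝ}
    (hle : ∀ a, |q x a| ≤ B) : |polAct po q x| ≤ B :=
  abs_le.2 ⟨le_polAct_of_le hpo fun a => (abs_le.1 (hle a)).1,
    polAct_le_of_le hpo fun a => (abs_le.1 (hle a)).2⟩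

lemma abs_mdpP_le [Fintype S] {P : S → A → S → ℝ} (hP : IsKernel P) {f : S → ℝ} {B : ℝ}
    (hle : ∀ z, |f z| ≤ B) (x : S) (a : A) : |mdpP P f x a| ≤ B :=
  abs_le.2 ⟨le_mdpP hP (fun z => (abs_le.1 (hle z)).1) x a,
    mdpP_le hP (fun z => (abs_le.1 (hle z)).2) x a⟩

lemma isPolicy_detPol [Fintype A] [DecidableEq A] (d : S → A) : IsPolicy (detPol d) := by
  refine ⟨fun x a => ?_, fun x => by simp [detPol]⟩
  unfold detPol
  split_ifs <;> norm_num

lemma polAct_detPol [Fintype A] [DecidableEq A] (d : S → A) (q : S → A → ℝ) (x : S) :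
    polAct (detPol d) q x = q x (d x) := by
  simp [polAct, detPol]

/-- A function on a finite type whose upper bounds improve under `B ↦ γ * B + c` is bounded by
the fixed point of that map. -/
lemma le_of_contracting_bound {ι : Type*} [Finite ι] {f : ι → ℝ} {γ H c : ℝ}
    (hγ1 : γ < 1) (hH : H * (1 - γ) = 1)
    (h : ∀ B, (∀ i, f i ≤ B) → ∀ i, f i ≤ γ * B + c) (i : ι) : f i ≤ H * c := by
  have : Nonempty ι := ⟨i⟩
  obtain ⟨j, hj⟩ := Finite.exists_max f
  have h1 := h (f j) hj j
  have hH0 : 0 < H := by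
    by_contra! hneg
    nlinarith
  have h2 : f j * (1 - γ) ≤ c := by linarith
  have h3 : H * (f j * (1 - γ)) = f j := by linear_combination f j * hH
  have h4 := mul_le_mul_of_nonneg_left h2 hH0.le
  linarith [hj i]

variable [Fintype S] [Fintype A] {P : S → A → S → ℝ} {r : S → A → ℝ} {γ H : ℝ}

lemma abs_bellmanOp_le (hP : IsKernel P) (hr : ∀ x a, |r x a| ≤ 1) (hγ0 : 0 ≤ γ)
    {po : S → A → ℝ} (hpo : IsPolicy po) {q : S → A → ℝ} {B : ℝ} (hq : ∀ x a, |q x a| ≤ B)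
    (x : S) (a : A) : |bellmanOp P r γ po q x a| ≤ γ * B + 1 := by
  have h1 := abs_mdpP_le hP (fun z => abs_polAct_le hpo (hq z)) x a
  have h2 := mul_le_mul_of_nonneg_left h1 hγ0
  have h3 := abs_add_le (r x a) (γ * mdpP P (polAct po q) x a)
  rw [abs_mul, abs_of_nonneg hγ0] at h3
  unfold bellmanOp
  linarith [hr x a]

lemma abs_fixedPoint_bellmanOp_le (hP : IsKernel P) (hr : ∀ x a, |r x a| ≤ 1) (hγ0 : 0 ≤ γ)
    (hγ1 : γ < 1) (hH : H * (1 - γ) = 1) {po : S → A → ℝ} (hpo : IsPolicy po) {q : S → A → ℝ}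
    (hq : bellmanOp P r γ po q = q) (x : S) (a : A) : |q x a| ≤ H := by
  have := le_of_contracting_bound (f := fun p : S × A => |q p.1 p.2|) (c := 1) hγ1 hH
    (fun B hB p => by
      have := abs_bellmanOp_le hP hr hγ0 hpo (q := q) (B := B) (fun x a => hB (x, a)) p.1 p.2
      rwa [hq] at this) (x, a)
  simpa using this

/-- Policy improvement: the values of an optimal policy are not improved by a greedy step. -/
lemma le_polAct_of_optimal [DecidableEq A] [Nonempty A] (hP : IsKernel P) (hγ0 : 0 ≤ γ)
    (hγ1 : γ < 1) (hH : H * (1 - γ) = 1) {Qpol : (S → A → ℝ) → S → A → ℝ}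
    (hQ : ∀ po, IsPolicy po → bellmanOp P r γ po (Qpol po) = Qpol po)
    {pstar : S → A → ℝ} (hpstar : IsPolicy pstar)
    (hopt : ∀ po, IsPolicy po → ∀ x, polAct po (Qpol po) x ≤ polAct pstar (Qpol pstar) x)
    (x : S) (a : A) : Qpol pstar x a ≤ polAct pstar (Qpol pstar) x := by
  choose d hd using fun x => Finite.exists_max (Qpol pstar x)
  have hle := le_of_contracting_bound
    (f := fun p : S × A => Qpol pstar p.1 p.2 - Qpol (detPol d) p.1 p.2) (c := 0) hγ1 hH
    (fun B hB p => by
      have h1 := congrFun (congrFun (hQ _ hpstar) p.1) p.2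
      have h2 := congrFun (congrFun (hQ _ (isPolicy_detPol d)) p.1) p.2
      unfold bellmanOp at h1 h2
      have h3 := mdpP_le_combination hP (f := polAct pstar (Qpol pstar))
        (g := polAct (detPol d) (Qpol (detPol d))) (h := fun _ => 0) (c := 1) (d := 0) (B := B)
        (fun z => by
          have h4 := hB (z, d z)
          have h5 := polAct_le_of_le hpstar (hd z)
          rw [polAct_detPol]
          simp only at h4
          linarith) p.1 p.2
      have h6 := mul_le_mul_of_nonneg_left h3 hγ0
      linarith) (x, d x)
  have h7 := hopt _ (isPolicy_detPol d) x
  rw [polAct_detPol] at h7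
  simp only at hle
  linarith [hd x a]

end MDPLemmas

section ScaledValueIteration

variable {S A : Type} [Fintype S] {P : S → A → S → ℝ} {r : S → A → ℝ}
  {γ H α η : ℝ} {K : ℕ} {w : ℕ → S → ℝ} {s E : ℕ → S → A → ℝ} {pol : ℕ → S → A}

lemma scaled_optimal_sub_le [Fintype A] (hP : IsKernel P) (hγ0 : 0 ≤ γ)
    (hH : H * (1 - γ) = 1) (hH1 : 1 ≤ H) (hα : α = 1 - (1 - γ) ^ 2) (hη : 0 ≤ η)
    (hs0 : ∀ x a, s 0 x a = 0)
    (hs : ∀ k x a, s (k + 1) x a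
      = H ^ 2 * (1 - α ^ (k + 1)) * r x a + γ * mdpP P (w k) x a + E (k + 1) x a)
    (hsw : ∀ k x a, s k x a ≤ w k x)
    (hE : ∀ k ≤ K, ∀ x a, |E k x a| ≤ 3 * H * η)
    {q : S → A → ℝ} {po : S → A → ℝ} (hpo : IsPolicy po) (hq : bellmanOp P r γ po q = q)
    (hqH : ∀ x a, |q x a| ≤ H) :
    ∀ k ≤ K, ∀ x a, H ^ 2 * (1 - α ^ k) * q x a - s k x a
      ≤ H ^ 2 * α ^ k + 3 * H ^ 2 * η := by
  have hα0 : 0 ≤ α := by nlinarith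
  have hα1 : α ≤ 1 := by nlinarith
  have hHα : H ^ 2 * (1 - α) = 1 := by
    rw [hα]; linear_combination (H * (1 - γ) + 1) * hH
  intro k
  induction k with
  | zero =>
    intro _ x a
    rw [hs0]
    simp
    positivity
  | succ k ih =>
    intro hk x a
    have hαk : 0 ≤ α ^ k := pow_nonneg hα0 k
    have hαk1 : α ^ k ≤ 1 := pow_le_one₀ hα0 hα1
    have hstate : ∀ z, H ^ 2 * (1 - α ^ (k + 1)) * polAct po q z
        ≤ w k z + (H ^ 2 * α ^ k + 3 * H ^ 2 * η + α ^ k * H) := fun z => by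
      have hcoef : 0 ≤ H ^ 2 * (1 - α ^ k) := mul_nonneg (sq_nonneg H) (by linarith)
      have h1 : polAct po (fun x a => H ^ 2 * (1 - α ^ k) * q x a) z
          = H ^ 2 * (1 - α ^ k) * polAct po q z := by
        simp only [polAct, Finset.mul_sum]
        exact Finset.sum_congr rfl fun a _ => by ring
      have h2 : polAct po (fun x a => H ^ 2 * (1 - α ^ k) * q x a) z
          ≤ w k z + (H ^ 2 * α ^ k + 3 * H ^ 2 * η) :=
        polAct_le_of_le hpo fun a => by linarith [ih (by omega) z a, hsw k z a]
      have h3 := mul_le_mul_of_nonneg_left (abs_le.1 (abs_polAct_le hpo (hqH z))).2 hαk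
      have h4 : H ^ 2 * (1 - α ^ (k + 1)) = H ^ 2 * (1 - α ^ k) + α ^ k := by
        rw [pow_succ]; linear_combination α ^ k * hHα
      rw [h4]
      linarith
    have h5 := mdpP_le_combination hP (f := fun z => H ^ 2 * (1 - α ^ (k + 1)) * polAct po q z)
      (g := w k) (h := w k) (c := 1) (d := 0) (B := H ^ 2 * α ^ k + 3 * H ^ 2 * η + α ^ k * H)
      (fun z => by linarith [hstate z]) x a
    have h6 : mdpP P (fun z => H ^ 2 * (1 - α ^ (k + 1)) * polAct po q z) x a
        = H ^ 2 * (1 - α ^ (k + 1)) * mdpP P (polAct po q) x a := by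
      simp only [mdpP, Finset.mul_sum]
      exact Finset.sum_congr rfl fun a _ => by ring
    have h7 := congrFun (congrFun hq x) a
    unfold bellmanOp at h7
    rw [h6] at h5
    have h8 := mul_le_mul_of_nonneg_left h5 hγ0
    have h9 := (abs_le.1 (hE (k + 1) hk x a)).1
    have h10 : γ * (H ^ 2 * α ^ k + 3 * H ^ 2 * η + α ^ k * H) + 3 * H * η
        = H ^ 2 * α ^ (k + 1) + 3 * H ^ 2 * η := by
      rw [pow_succ, hα]
      linear_combination (-γ * H * (1 - (1 - γ) ^ 2) ^ k - 3 * H * η) * hH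
    rw [hs, ← h7]
    linarith

lemma sub_scaled_nonstationary_le [Fintype A] [DecidableEq A] (hP : IsKernel P) (hγ0 : 0 ≤ γ)
    (hH : H * (1 - γ) = 1) (hH1 : 1 ≤ H) (hα : α = 1 - (1 - γ) ^ 2)
    (hw0 : ∀ x, w 0 x = 0)
    (hs : ∀ k x a, s (k + 1) x a
      = H ^ 2 * (1 - α ^ (k + 1)) * r x a + γ * mdpP P (w k) x a + E (k + 1) x a)
    (hws : ∀ k x, w k x = s k x (pol k x))
    (hE : ∀ k ≤ K, ∀ x a, |E k x a| ≤ 3 * H * η) (hη : 0 ≤ η)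
    {u : ℕ → S → A → ℝ} (hu0 : bellmanOp P r γ (detPol (pol 0)) (u 0) = u 0)
    (hurec : ∀ k, u (k + 1) = bellmanOp P r γ (detPol (pol (k + 1))) (u k))
    (huH : ∀ k x a, |u k x a| ≤ H) :
    ∀ k, k + 1 ≤ K → ∀ x a, s (k + 1) x a - H ^ 2 * (1 - α ^ (k + 1)) * u k x a
      ≤ H ^ 2 * α ^ (k + 1) + 3 * H ^ 2 * η := by
  have hα0 : 0 ≤ α := by nlinarith
  have hHα : H ^ 2 * (1 - α) = 1 := by
    rw [hα]; linear_combination (H * (1 - γ) + 1) * hH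
  have step : ∀ k, k + 1 ≤ K → ∀ q : S → A → ℝ, (∀ x a, |q x a| ≤ H) →
      u k = bellmanOp P r γ (detPol (pol k)) q →
      (∀ z, w k z - H ^ 2 * (1 - α ^ k) * q z (pol k z) ≤ H ^ 2 * α ^ k + 3 * H ^ 2 * η) →
      ∀ x a, s (k + 1) x a - H ^ 2 * (1 - α ^ (k + 1)) * u k x a
        ≤ H ^ 2 * α ^ (k + 1) + 3 * H ^ 2 * η := by
    intro k hk q hqH hu hprev x a
    have hαk : 0 ≤ α ^ k := pow_nonneg hα0 k
    have h4 : H ^ 2 * (1 - α ^ (k + 1)) = H ^ 2 * (1 - α ^ k) + α ^ k := by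
      rw [pow_succ]; linear_combination α ^ k * hHα
    have h5 := mdpP_le_combination hP (f := w k) (g := polAct (detPol (pol k)) q)
      (h := polAct (detPol (pol k)) q) (c := H ^ 2 * (1 - α ^ (k + 1))) (d := 0)
      (B := H ^ 2 * α ^ k + 3 * H ^ 2 * η + α ^ k * H) (fun z => by
        rw [polAct_detPol, h4]
        have h3 := mul_le_mul_of_nonneg_left (abs_le.1 (hqH z (pol k z))).1 hαk
        linarith [hprev z]) x a
    have h8 := mul_le_mul_of_nonneg_left h5 hγ0
    have h9 := (abs_le.1 (hE (k + 1) hk x a)).2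
    have h10 : γ * (H ^ 2 * α ^ k + 3 * H ^ 2 * η + α ^ k * H) + 3 * H * η
        = H ^ 2 * α ^ (k + 1) + 3 * H ^ 2 * η := by
      rw [pow_succ, hα]
      linear_combination (-γ * H * (1 - (1 - γ) ^ 2) ^ k - 3 * H * η) * hH
    rw [hs, hu]
    unfold bellmanOp
    linarith
  intro k
  induction k with
  | zero =>
    intro hk
    refine step 0 hk (u 0) (huH 0) hu0.symm fun z => ?_
    rw [hw0]
    simp
    positivity
  | succ k ih =>
    intro hk
    refine step (k + 1) hk (u k) (huH k) (hurec k) fun z => ?_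
    rw [hws]
    exact ih (by omega) z _

lemma abs_iterate_diff_le (hP : IsKernel P) (hr : ∀ x a, |r x a| ≤ 1) (hγ0 : 0 ≤ γ)
    (hH : H * (1 - γ) = 1) (hH1 : 1 ≤ H) (hα : α = 1 - (1 - γ) ^ 2)
    (hs0 : ∀ x a, s 0 x a = 0) (hw0 : ∀ x, w 0 x = 0)
    (hs : ∀ k x a, s (k + 1) x a
      = H ^ 2 * (1 - α ^ (k + 1)) * r x a + γ * mdpP P (w k) x a + E (k + 1) x a)
    (hws : ∀ k x, w k x = s k x (pol k x)) (hsw : ∀ k x a, s k x a ≤ w k x)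
    (hE : ∀ k ≤ K, ∀ x a, |E k x a| ≤ 3 * H * η) (hη : 0 ≤ η)
    (hEdiff : ∀ k, k + 1 ≤ K → ∀ x a, |E (k + 1) x a - E k x a| ≤ 6 * η) :
    ∀ k, k + 1 ≤ K → ∀ x, |w (k + 1) x - w k x| ≤ 2 * H * α ^ k + 6 * H * η := by
  have hα0 : 0 ≤ α := by nlinarith
  have hHα : H ^ 2 * (1 - α) = 1 := by
    rw [hα]; linear_combination (H * (1 - γ) + 1) * hH
  have hmax : ∀ k B, (∀ x a, |s (k + 1) x a - s k x a| ≤ B) →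
      ∀ x, |w (k + 1) x - w k x| ≤ B := by
    intro k B hB x
    have h1 := (abs_le.1 (hB x (pol (k + 1) x))).2
    have h2 := (abs_le.1 (hB x (pol k x))).1
    have h3 := hsw k x (pol (k + 1) x)
    have h4 := hsw (k + 1) x (pol k x)
    rw [← hws] at h1 h2
    exact abs_le.2 ⟨by linarith, by linarith⟩
  intro k
  induction k with
  | zero =>
    intro hk
    refine hmax 0 _ fun x a => ?_
    have h1 : mdpP P (w 0) x a = 0 := by simp [mdpP, hw0]
    have h2 := abs_le.1 (hr x a)
    have h3 := abs_le.1 (hE 1 hk x a)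
    have h4 : 0 ≤ H * η := by positivity
    rw [hs0, hs, h1, zero_add, pow_one, hHα]
    exact abs_le.2 ⟨by simp; linarith, by simp; linarith⟩
  | succ k ih =>
    intro hk
    refine hmax (k + 1) _ fun x a => ?_
    have hαk : 0 ≤ α ^ k := pow_nonneg hα0 k
    have hd := ih (by omega)
    have h1 := mdpP_le_combination hP (f := w (k + 1)) (g := w k) (h := w k) (c := 1) (d := 0)
      (B := 2 * H * α ^ k + 6 * H * η) (fun z => by linarith [(abs_le.1 (hd z)).2]) x a
    have h2 := mdpP_le_combination hP (f := w k) (g := w (k + 1)) (h := w k) (c := 1) (d := 0)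
      (B := 2 * H * α ^ k + 6 * H * η) (fun z => by linarith [(abs_le.1 (hd z)).1]) x a
    have h1' := mul_le_mul_of_nonneg_left h1 hγ0
    have h2' := mul_le_mul_of_nonneg_left h2 hγ0
    have h3 := abs_le.1 (hEdiff (k + 1) hk x a)
    have hαk1 : 0 ≤ α ^ (k + 1) := pow_nonneg hα0 _
    have h4 := mul_le_mul_of_nonneg_left (abs_le.1 (hr x a)).1 hαk1
    have h5 := mul_le_mul_of_nonneg_left (abs_le.1 (hr x a)).2 hαk1
    have h6 : H ^ 2 * (1 - α ^ (k + 1 + 1)) = H ^ 2 * (1 - α ^ (k + 1)) + α ^ (k + 1) := by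
      rw [pow_succ]; linear_combination α ^ (k + 1) * hHα
    have h7 : γ * (2 * H * α ^ k + 6 * H * η) + α ^ (k + 1) + 6 * η
        ≤ 2 * H * α ^ (k + 1) + 6 * H * η := by
      have h8 : 2 * H * α ^ (k + 1) + 6 * H * η
          - (γ * (2 * H * α ^ k + 6 * H * η) + α ^ (k + 1) + 6 * η) = α ^ k * γ ^ 2 := by
        rw [pow_succ, hα]
        linear_combination (2 * γ * (1 - (1 - γ) ^ 2) ^ k + 6 * η) * hH
      have h9 : 0 ≤ α ^ k * γ ^ 2 := by positivity
      linarith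
    rw [hs (k + 1), hs k, h6]
    exact abs_le.2 ⟨by linarith, by linarith⟩

lemma sub_scaled_stationary_le [Fintype A] [DecidableEq A] (hP : IsKernel P)
    (hγ0 : 0 ≤ γ) (hγ1 : γ < 1)
    (hH : H * (1 - γ) = 1) (hH1 : 1 ≤ H) (hα : α = 1 - (1 - γ) ^ 2) (hη : 0 ≤ η)
    (hs : ∀ k x a, s (k + 1) x a
      = H ^ 2 * (1 - α ^ (k + 1)) * r x a + γ * mdpP P (w k) x a + E (k + 1) x a)
    (hws : ∀ k x, w k x = s k x (pol k x)) {k : ℕ}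
    (hE : ∀ x a, |E (k + 1) x a| ≤ 3 * H * η)
    (hdiff : ∀ x, |w (k + 1) x - w k x| ≤ 2 * H * α ^ k + 6 * H * η)
    {q : S → A → ℝ} (hq : bellmanOp P r γ (detPol (pol (k + 1))) q = q) (x : S) :
    w (k + 1) x - H ^ 2 * (1 - α ^ (k + 1)) * q x (pol (k + 1) x)
      ≤ 2 * H ^ 2 * α ^ (k + 1) + 9 * H ^ 2 * η := by
  have hα0 : 0 ≤ α := by nlinarith
  have hγα : γ ≤ α := by nlinarith
  have hαk : 0 ≤ α ^ k := pow_nonneg hα0 k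
  have hmain := le_of_contracting_bound
    (f := fun x => w (k + 1) x - H ^ 2 * (1 - α ^ (k + 1)) * q x (pol (k + 1) x))
    (c := γ * (2 * H * α ^ k + 6 * H * η) + 3 * H * η) hγ1 hH (fun B hB x => by
      have h1 := mdpP_le_combination hP (f := w k) (g := polAct (detPol (pol (k + 1))) q)
        (h := fun _ => 0) (c := H ^ 2 * (1 - α ^ (k + 1))) (d := 0)
        (B := B + (2 * H * α ^ k + 6 * H * η)) (fun z => by
          rw [polAct_detPol]
          linarith [hB z, (abs_le.1 (hdiff z)).1]) x (pol (k + 1) x)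
      have h2 := mul_le_mul_of_nonneg_left h1 hγ0
      have h3 := congrFun (congrFun hq x) (pol (k + 1) x)
      unfold bellmanOp at h3
      have h4 := (abs_le.1 (hE x (pol (k + 1) x))).2
      rw [hws, hs, ← h3]
      linarith) x
  refine hmain.trans ?_
  have h5 : γ * α ^ k ≤ α ^ (k + 1) := by
    rw [pow_succ']; exact mul_le_mul_of_nonneg_right hγα hαk
  have h6 : γ * (H ^ 2 * η) ≤ H ^ 2 * η := by
    have : 0 ≤ H ^ 2 * η := by positivity
    nlinarith
  have h7 := mul_le_mul_of_nonneg_left h5 (sq_nonneg H)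
  nlinarith

end ScaledValueIteration

/-- Converts a bound on a suboptimality gap scaled by `H ^ 2 * (1 - b)` into an unscaled one. -/
lemma sub_le_of_scaled_sub_le {H b η V V' c d : ℝ} (hH1 : 1 ≤ H) (hb : 0 ≤ b)
    (hV : |V| ≤ H) (hV' : |V'| ≤ H) (hc : 0 ≤ c)
    (h : H ^ 2 * (1 - b) * V - H ^ 2 * (1 - b) * V' ≤ c * H ^ 2 * b + d * H ^ 2 * η) :
    V - V' ≤ (c + 2) * H * b + d * η := by
  have hH2 : 0 < H ^ 2 := by positivity
  have h1 : (1 - b) * (V - V') ≤ c * b + d * η := by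
    refine le_of_mul_le_mul_left ?_ hH2
    linarith
  have h2 := mul_le_mul_of_nonneg_left
    (by linarith [(abs_le.1 hV).2, (abs_le.1 hV').1] : V - V' ≤ 2 * H) hb
  have h3 : c * b ≤ c * b * H := le_mul_of_one_le_right (by positivity) hH1
  linarith

/-- The sample size makes the concentration radius of order `ε * √H`. -/
lemma three_mul_sqrt_div_le {H ε ι L M : ℝ} (hH : 0 < H) (hε : 0 < ε) (hM : 0 < M)
    (hι : ι ≤ L) (hML : H / ε ^ 2 * L ≤ M) :
    3 * H * √(ι / M) ≤ 3 * (ε * √H) := by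
  have h1 : ι / M ≤ ε ^ 2 / H := by
    rw [div_le_div_iff₀ hM hH]
    have h2 : H * L ≤ M * ε ^ 2 := by
      rw [div_mul_eq_mul_div, div_le_iff₀ (by positivity)] at hML
      exact hML
    nlinarith [mul_le_mul_of_nonneg_left hι hH.le]
  have h3 : H * √(ε ^ 2 / H) = ε * √H := by
    rw [Real.sqrt_div (sq_nonneg ε), Real.sqrt_sq hε.le]
    have : √H ≠ 0 := (Real.sqrt_pos.2 hH).ne'
    field_simp
    rw [Real.sq_sqrt hH.le]
  have h4 := mul_le_mul_of_nonneg_left (Real.sqrt_le_sqrt h1) hH.le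
  linarith

/-- Lemma 4.10: coarse bound for the last policy. -/
theorem mdvi_coarse_bound_last_policy :
    ∃ C c₃ c₄ : ℝ, 0 < C ∧ 1 ≤ c₃ ∧ 1 ≤ c₄ ∧
    ∀ (α : ℝ)
    (S A : Type) [Fintype S] [Fintype A] [Nonempty S] [Nonempty A] [DecidableEq A]
    (P : S → A → S → ℝ) (hP : IsKernel P)
    (r : S → A → ℝ) (hr : ∀ x a, |r x a| ≤ 1)
    (γ H : ℝ) (hγ0 : 0 ≤ γ) (hγ1 : γ < 1) (hH : H = 1 / (1 - γ))
    (Qpol : (S → A → ℝ) → S → A → ℝ)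
    (hQ : ∀ po, IsPolicy po → bellmanOp P r γ po (Qpol po) = Qpol po)
    (pstar : S → A → ℝ) (hpstar : IsPolicy pstar)
    (hopt : ∀ po, IsPolicy po → ∀ x, polAct po (Qpol po) x ≤ polAct pstar (Qpol pstar) x)
    (K M : ℕ) (hM : 1 ≤ M)
    (y : ℕ → ℕ → S → A → S)
    (w v : ℕ → S → ℝ) (sq qv : ℕ → S → A → ℝ)
    (hs0 : ∀ x a, sq 0 x a = 0) (hw0 : ∀ x, w 0 x = 0)
    (hv : ∀ k x, v k x = w k x - α * w (k - 1) x)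
    (hqv : ∀ k x a, qv (k + 1) x a
      = r x a + (γ / (M : ℝ)) * ∑ m ∈ Finset.range M, v k (y k m x a))
    (hsq : ∀ k x a, sq (k + 1) x a = qv (k + 1) x a + α * sq k x a)
    (hwk : ∀ k x, w (k + 1) x = ⨆ a, sq (k + 1) x a)
    (pol : ℕ → S → A)
    (hgreedy : ∀ k x a, sq k x a ≤ sq k x (pol k x))
    (εf Ef : ℕ → S → A → ℝ)
    (hεf : ∀ k x a, εf (k + 1) x a
      = (γ / (M : ℝ)) * ∑ m ∈ Finset.range M, v k (y k m x a) - γ * mdpP P (v k) x a)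
    (hEf : ∀ k x a, Ef k x a = ∑ j ∈ Finset.range k, α ^ (k - 1 - j) * εf (j + 1) x a)
    (u : ℕ → S → A → ℝ)
    (hu0 : u 0 = Qpol (detPol (pol 0)))
    (hurec : ∀ k, u (k + 1) = bellmanOp P r γ (detPol (pol (k + 1))) (u k))
    (ε : ℝ) (hε0 : 0 < ε) (hε1 : ε ≤ 1)
    (δ : ℝ) (hδ0 : 0 < δ) (hδ1 : δ < 1)
    (hαγ : α = 1 - (1 - γ) ^ 2)
    (hKdef : K = ⌈(5 / (1 - α)) * Real.log (c₃ * H / ε) + 2⌉₊)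
    (hMdef : M = ⌈(c₄ * H / ε ^ 2) *
        Real.log ((16 * K * Fintype.card S * Fintype.card A : ℝ) / δ)⌉₊)
    (hE1 : ∀ k ∈ Finset.Icc 1 K, ∀ x a, |Ef k x a|
      < 3 * H * Real.sqrt (((1 : ℝ) / (1 - α)) *
          Real.log ((8 * K * Fintype.card S * Fintype.card A : ℝ) / δ) / (M : ℝ)))
    (hE2 : ∀ k ∈ Finset.Icc 1 K, ∀ x a, |εf k x a|
      < 3 * H * Real.sqrt (
          Real.log ((8 * K * Fintype.card S * Fintype.card A : ℝ) / δ) / (M : ℝ))),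
    ∀ k ∈ Finset.Icc 1 K,
      (∀ x, |polAct pstar (Qpol pstar) x - polAct (detPol (pol k)) (u (k - 1)) x| ≤
          C * H * α ^ k + C * ε * Real.sqrt (H / c₄)) ∧
      (∀ x, |polAct pstar (Qpol pstar) x
            - polAct (detPol (pol k)) (Qpol (detPol (pol k))) x| ≤
          C * H * α ^ k + C * ε * Real.sqrt (H / c₄)) := by
  refine ⟨12, 1, 1, by norm_num, le_rfl, le_rfl, ?_⟩
  intro α S A _ _ _ _ _ P hP r hr γ H hγ0 hγ1 hH Qpol hQ pstar hpstar hopt K M hM y w v sq qv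
    hs0 hw0 hv hqv hsq hwk pol hgreedy εf Ef hεf hEf u hu0 hurec ε hε0 hε1 δ hδ0 hδ1 hαγ hKdef
    hMdef hE1 hE2 k hk
  obtain ⟨hk1, hkK⟩ := Finset.mem_Icc.1 hk
  have hHγ : H * (1 - γ) = 1 := by
    rw [hH]; exact one_div_mul_cancel (by linarith)
  have hH1 : 1 ≤ H := by
    rw [hH, le_div_iff₀ (by linarith)]; linarith
  have hHα : H ^ 2 * (1 - α) = 1 := by
    rw [hαγ]; linear_combination (H * (1 - γ) + 1) * hHγ
  have hα0 : 0 ≤ α := by nlinarith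
  have hα1 : 0 < 1 - α := by
    rw [hαγ]
    have : 0 < 1 - γ := by linarith
    linarith [pow_pos this 2]
  set η := ε * √H with hη_def
  have hη : 0 ≤ η := by positivity
  have hM0 : (0 : ℝ) < M := by exact_mod_cast hM
  have hK0 : (0 : ℝ) < K := by exact_mod_cast hk1.trans hkK
  have hS0 : (0 : ℝ) < Fintype.card S := by exact_mod_cast Fintype.card_pos
  have hA0 : (0 : ℝ) < Fintype.card A := by exact_mod_cast Fintype.card_pos
  have hlog : Real.log ((8 * K * Fintype.card S * Fintype.card A : ℝ) / δ)
      ≤ Real.log ((16 * K * Fintype.card S * Fintype.card A : ℝ) / δ) := by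
    refine Real.log_le_log (by positivity) ?_
    gcongr
    norm_num
  have hML : H / ε ^ 2 * Real.log ((16 * K * Fintype.card S * Fintype.card A : ℝ) / δ) ≤ M := by
    have := Nat.le_ceil ((1 * H / ε ^ 2) *
        Real.log ((16 * K * Fintype.card S * Fintype.card A : ℝ) / δ))
    rw [← hMdef, one_mul] at this
    exact this
  have hrad := three_mul_sqrt_div_le (by linarith : 0 < H) hε0 hM0 hlog hML
  have hε_le : ∀ j, j + 1 ≤ K → ∀ x a, |εf (j + 1) x a| ≤ 3 * η := fun j hj x a =>
    (hE2 (j + 1) (Finset.mem_Icc.2 ⟨by omega, hj⟩) x a).le.trans hrad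
  have hE0 : ∀ x a, Ef 0 x a = 0 := fun x a => by simp [hEf]
  have hE_le : ∀ j ≤ K, ∀ x a, |Ef j x a| ≤ 3 * H * η := by
    intro j hj x a
    rcases Nat.eq_zero_or_pos j with rfl | hj0
    · rw [hE0, abs_zero]; positivity
    · refine (hE1 j (Finset.mem_Icc.2 ⟨hj0, hj⟩) x a).le.trans ?_
      have h1 : (1 : ℝ) / (1 - α) = H ^ 2 := by
        rw [div_eq_iff hα1.ne', hHα]
      rw [h1, mul_div_assoc, Real.sqrt_mul (sq_nonneg H), Real.sqrt_sq (by linarith)]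
      nlinarith
  have hEsucc : ∀ j x a, Ef (j + 1) x a = εf (j + 1) x a + α * Ef j x a := by
    intro j x a
    rw [hEf, hEf, Finset.sum_range_succ, Finset.mul_sum, add_comm]
    congr 1
    · simp
    · refine Finset.sum_congr rfl fun i hi => ?_
      have hi := Finset.mem_range.1 hi
      rw [show j + 1 - 1 - i = (j - 1 - i) + 1 by omega, pow_succ]
      ring
  have hEdiff : ∀ j, j + 1 ≤ K → ∀ x a, |Ef (j + 1) x a - Ef j x a| ≤ 6 * η := by
    intro j hj x a
    have h1 := abs_le.1 (hε_le j hj x a)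
    have h2 := abs_le.1 (hE_le j (by omega) x a)
    have h3 : (1 - α) * (3 * H * η) ≤ 3 * η := by
      have h4 : (1 - α) * H ≤ 1 := by
        nlinarith [mul_le_mul_of_nonneg_left hH1 (by positivity : 0 ≤ (1 - α) * H)]
      nlinarith
    have h5 := mul_le_mul_of_nonneg_left h2.1 hα1.le
    have h6 := mul_le_mul_of_nonneg_left h2.2 hα1.le
    rw [hEsucc]
    exact abs_le.2 ⟨by linarith, by linarith⟩
  have hws : ∀ j x, w j x = sq j x (pol j x) := by
    intro j x
    cases j with
    | zero => rw [hw0, hs0]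
    | succ j =>
      rw [hwk]
      exact le_antisymm (ciSup_le fun a => hgreedy _ x a)
        (le_ciSup (Set.finite_range _).bddAbove _)
  have hsw : ∀ j x a, sq j x a ≤ w j x := fun j x a => (hgreedy j x a).trans (hws j x).ge
  have hs : ∀ j x a, sq (j + 1) x a
      = H ^ 2 * (1 - α ^ (j + 1)) * r x a + γ * mdpP P (w j) x a + Ef (j + 1) x a := by
    intro j
    induction j with
    | zero =>
      intro x a
      have h1 : mdpP P (v 0) x a = 0 := by simp [mdpP, hv, hw0]
      have h2 : mdpP P (w 0) x a = 0 := by simp [mdpP, hw0]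
      have h3 := hεf 0 x a
      rw [hsq, hqv, hs0, hEsucc, hE0, h2, zero_add, pow_one, hHα, h3, h1]
      ring
    | succ j ih =>
      intro x a
      have h1 : mdpP P (v (j + 1)) x a = mdpP P (w (j + 1)) x a - α * mdpP P (w j) x a := by
        simp only [mdpP, Finset.mul_sum, ← Finset.sum_sub_distrib]
        refine Finset.sum_congr rfl fun z _ => ?_
        rw [hv, Nat.add_sub_cancel]
        ring
      have h3 := hεf (j + 1) x a
      rw [hsq, hqv, ih, hEsucc (j + 1), h3, h1, pow_succ α (j + 1)]
      linear_combination (-r x a) * hHα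
  have hdet : ∀ j, IsPolicy (detPol (pol j)) := fun j => isPolicy_detPol (pol j)
  have hQH : ∀ po, IsPolicy po → ∀ x a, |Qpol po x a| ≤ H := fun po hpo =>
    abs_fixedPoint_bellmanOp_le hP hr hγ0 hγ1 hHγ hpo (hQ po hpo)
  have huH : ∀ j x a, |u j x a| ≤ H := by
    intro j
    induction j with
    | zero => rw [hu0]; exact hQH _ (hdet 0)
    | succ j ih =>
      intro x a
      rw [hurec]
      have := abs_bellmanOp_le hP hr hγ0 (hdet (j + 1)) ih x a
      linarith
  have hgap := scaled_optimal_sub_le hP hγ0 hHγ hH1 hαγ hη hs0 hs hsw hE_le hpstar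
    (hQ _ hpstar) (hQH _ hpstar)
  have hub := le_polAct_of_optimal hP hγ0 hγ1 hHγ hQ hpstar hopt
  have hu_le : ∀ j x a, u j x a ≤ Qpol pstar x a := by
    have hmono : ∀ (d : S → A) (q : S → A → ℝ), (∀ z, q z (d z) ≤ polAct pstar (Qpol pstar) z) →
        ∀ x a, bellmanOp P r γ (detPol d) q x a ≤ Qpol pstar x a := by
      intro d q hq x a
      have h1 := mdpP_le_combination hP (f := polAct (detPol d) q)
        (g := polAct pstar (Qpol pstar)) (h := fun _ => 0) (c := 1) (d := 0) (B := 0)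
        (fun z => by rw [polAct_detPol]; linarith [hq z]) x a
      have h2 := mul_le_mul_of_nonneg_left h1 hγ0
      have h3 := congrFun (congrFun (hQ _ hpstar) x) a
      rw [← h3]
      unfold bellmanOp
      linarith
    intro j
    induction j with
    | zero =>
      rw [hu0, ← hQ _ (hdet 0)]
      refine hmono _ _ fun z => ?_
      have := hopt _ (hdet 0) z
      rwa [polAct_detPol] at this
    | succ j ih =>
      rw [hurec]
      exact hmono _ _ fun z => (ih z _).trans (hub z _)
  obtain ⟨n, rfl⟩ : ∃ n, k = n + 1 := ⟨k - 1, by omega⟩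
  have hb : 0 ≤ α ^ (n + 1) := pow_nonneg hα0 _
  have hb1 : α ^ (n + 1) ≤ 1 := pow_le_one₀ hα0 (by linarith)
  have hgapV : ∀ x, H ^ 2 * (1 - α ^ (n + 1)) * polAct pstar (Qpol pstar) x - w (n + 1) x
      ≤ H ^ 2 * α ^ (n + 1) + 3 * H ^ 2 * η := by
    intro x
    have h1 : polAct pstar (fun x a => H ^ 2 * (1 - α ^ (n + 1)) * Qpol pstar x a) x
        = H ^ 2 * (1 - α ^ (n + 1)) * polAct pstar (Qpol pstar) x := by
      simp only [polAct, Finset.mul_sum]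
      exact Finset.sum_congr rfl fun a _ => by ring
    have h2 : polAct pstar (fun x a => H ^ 2 * (1 - α ^ (n + 1)) * Qpol pstar x a) x
        ≤ w (n + 1) x + (H ^ 2 * α ^ (n + 1) + 3 * H ^ 2 * η) :=
      polAct_le_of_le hpstar fun a => by
        linarith [hgap (n + 1) hkK x a, hsw (n + 1) x a]
    linarith
  have hVH : ∀ x, |polAct pstar (Qpol pstar) x| ≤ H := fun x =>
    abs_polAct_le hpstar (hQH _ hpstar x)
  have hHb : 0 ≤ H * α ^ (n + 1) := by positivity
  rw [div_one, Nat.add_sub_cancel]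
  refine ⟨fun x => ?_, fun x => ?_⟩
  · rw [polAct_detPol]
    have h1 := sub_scaled_nonstationary_le hP hγ0 hHγ hH1 hαγ hw0 hs hws hE_le hη
      (by rw [hu0]; exact hQ _ (hdet 0)) hurec huH n hkK x (pol (n + 1) x)
    rw [← hws] at h1
    have h2 := sub_le_of_scaled_sub_le (c := 2) (d := 6) (η := η) hH1 hb (hVH x)
      (huH n x (pol (n + 1) x)) (by norm_num) (by linarith [hgapV x])
    rw [abs_of_nonneg (by linarith [hu_le n x (pol (n + 1) x), hub x (pol (n + 1) x)])]
    linarith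
  · have h0 := hopt _ (hdet (n + 1)) x
    rw [polAct_detPol] at h0 ⊢
    have h1 := sub_scaled_stationary_le hP hγ0 hγ1 hHγ hH1 hαγ hη hs hws
      (hE_le (n + 1) hkK) (abs_iterate_diff_le hP hr hγ0 hHγ hH1 hαγ hs0 hw0 hs hws hsw hE_le hη
        hEdiff n hkK) (hQ _ (hdet (n + 1))) x
    have h2 := sub_le_of_scaled_sub_le (c := 3) (d := 12) (η := η) hH1 hb (hVH x)
      (hQH _ (hdet (n + 1)) x (pol (n + 1) x)) (by norm_num) (by linarith [hgapV x])
    rw [abs_of_nonneg (by linarith)]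
    linarith
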